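/- arXiv:1509.05984 — 6 statements merged into one kernel-verified Lean document; each statement's English description precedes it below -/
import Mathlib

section
/- Let A : Fin d → Matrix (Fin D) (Fin D) ℂ and let x y : Fin D → ℂ be vectors. Set V := vecMulVec x (star x) - vecMulVec y (star y) and W := vecMulVec x (star y). The following are equivalent: (a) for every N and every word w : Fin N → Fin d, trace ((A_w)ᴴ * V * A_w) = 0 and trace ((A_w)ᴴ * W * A_w) = 0; (b) there exists a ℂ-submodule S of Matrix (Fin D) (Fin D) ℂ such that V ∈ S, W ∈ S, every X ∈ S has trace X = 0, and for every i and every X ∈ S one has (A i)ᴴ * X * (A i) ∈ S. -/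
open Matrix BigOperators

/-- Ordered product `A (w 0) * A (w 1) * ⋯ * A (w (N-1))` along a word `w`;
the identity for the empty word. -/
noncomputable def wordProd {d D N : ℕ} (A : Fin d → Matrix (Fin D) (Fin D) ℂ)
    (w : Fin N → Fin d) : Matrix (Fin D) (Fin D) ℂ :=
  (List.ofFn fun k => A (w k)).prod

section

variable {d D N : ℕ} (A : Fin d → Matrix (Fin D) (Fin D) ℂ)

lemma wordProd_zero (w : Fin 0 → Fin d) : wordProd A w = 1 := by
  simp [wordProd]

lemma wordProd_succ (w : Fin (N + 1) → Fin d) :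
    wordProd A w = A (w 0) * wordProd A (Fin.tail w) := by
  simp [wordProd, Fin.tail, List.ofFn_succ]

lemma wordProd_cons (i : Fin d) (w : Fin N → Fin d) :
    wordProd A (Fin.cons i w : Fin (N + 1) → Fin d) = A i * wordProd A w := by
  rw [wordProd_succ, Fin.cons_zero, Fin.tail_cons]

/-- A set of matrices stable under conjugation by each `A i` is stable under conjugation by
every word in the `A i`. -/
lemma conjTranspose_wordProd_mul_mul_mem {S : Set (Matrix (Fin D) (Fin D) ℂ)}
    (hS : ∀ i, ∀ X ∈ S, (A i)ᴴ * X * A i ∈ S) (w : Fin N → Fin d)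
    {X : Matrix (Fin D) (Fin D) ℂ} (hX : X ∈ S) :
    (wordProd A w)ᴴ * X * wordProd A w ∈ S := by
  induction N generalizing X with
  | zero => simpa [wordProd_zero] using hX
  | succ N ih =>
    have h := ih (Fin.tail w) (hS (w 0) X hX)
    rw [wordProd_succ, conjTranspose_mul]
    simpa only [Matrix.mul_assoc] using h

/-- The matrices all of whose conjugates by words in the `A i` are traceless: the largest
subspace of traceless matrices stable under conjugation by each `A i`. -/
def wordTraceless : Submodule ℂ (Matrix (Fin D) (Fin D) ℂ) where
  carrier := {X | ∀ (N : ℕ) (w : Fin N → Fin d),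
    ((wordProd A w)ᴴ * X * wordProd A w).trace = 0}
  zero_mem' := by simp
  add_mem' hX hY N w := by simp [Matrix.mul_add, Matrix.add_mul, hX N w, hY N w]
  smul_mem' c X hX N w := by simp [hX N w]

variable {A}

lemma mem_wordTraceless {X : Matrix (Fin D) (Fin D) ℂ} :
    X ∈ wordTraceless A ↔ ∀ (N : ℕ) (w : Fin N → Fin d),
      ((wordProd A w)ᴴ * X * wordProd A w).trace = 0 :=
  Iff.rfl

lemma trace_eq_zero_of_mem_wordTraceless {X : Matrix (Fin D) (Fin D) ℂ}
    (hX : X ∈ wordTraceless A) : X.trace = 0 := by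
  simpa [wordProd_zero] using hX 0 Fin.elim0

lemma conjTranspose_mul_mul_mem_wordTraceless (i : Fin d) {X : Matrix (Fin D) (Fin D) ℂ}
    (hX : X ∈ wordTraceless A) : (A i)ᴴ * X * A i ∈ wordTraceless A := by
  intro N w
  have h := hX (N + 1) (Fin.cons i w)
  rw [wordProd_cons, conjTranspose_mul] at h
  simpa only [Matrix.mul_assoc] using h

end

theorem trace_conditions_iff_submodule (d D : ℕ)
    (A : Fin d → Matrix (Fin D) (Fin D) ℂ) (x y : Fin D → ℂ) :
    (∀ (N : ℕ) (w : Fin N → Fin d),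
      ((wordProd A w)ᴴ * (vecMulVec x (star x) - vecMulVec y (star y)) *
        wordProd A w).trace = 0 ∧
      ((wordProd A w)ᴴ * vecMulVec x (star y) * wordProd A w).trace = 0)
    ↔
    (∃ S : Submodule ℂ (Matrix (Fin D) (Fin D) ℂ),
      vecMulVec x (star x) - vecMulVec y (star y) ∈ S ∧
      vecMulVec x (star y) ∈ S ∧
      (∀ X ∈ S, X.trace = 0) ∧
      (∀ i : Fin d, ∀ X ∈ S, (A i)ᴴ * X * (A i) ∈ S)) := by
  constructor
  · intro h
    exact ⟨wordTraceless A, mem_wordTraceless.2 fun N w => (h N w).1,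
      mem_wordTraceless.2 fun N w => (h N w).2,
      fun _ => trace_eq_zero_of_mem_wordTraceless,
      fun i _ => conjTranspose_mul_mul_mem_wordTraceless i⟩
  · rintro ⟨S, hV, hW, htr, hS⟩ N w
    exact ⟨htr _ (conjTranspose_wordProd_mul_mul_mem A hS w hV),
      htr _ (conjTranspose_wordProd_mul_mul_mem A hS w hW)⟩
end

section
/- Let x y : Fin D → ℂ be orthonormal vectors, let P : Matrix (Fin D) (Fin 2) ℂ be the matrix whose two columns are x and y, and let M : Matrix (Fin D) (Fin D) ℂ. Set V := vecMulVec x (star x) - vecMulVec y (star y) and W := vecMulVec x (star y). Then there exists a real c ≥ 0 with (Pᴴ * M) * (Pᴴ * M)ᴴ = c • (1 : Matrix (Fin 2) (Fin 2) ℂ) if and only if trace (Mᴴ * V * M) = 0 and trace (Mᴴ * W * M) = 0. -/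
open Matrix BigOperators

/-- The Gram entries of `Pᴴ * M` are traces of `M`-conjugated rank-one matrices. -/
theorem trace_conjTranspose_mul_vecMulVec_mul {m n p : Type*} [Fintype m] [Fintype n]
    (P : Matrix m p ℂ) (M : Matrix m n ℂ) (i j : p) :
    (Mᴴ * vecMulVec (P.col j) (star (P.col i)) * M).trace = ((Pᴴ * M) * (Pᴴ * M)ᴴ) i j := by
  rw [mul_vecMulVec, vecMulVec_mul, trace_vecMulVec, dotProduct_comm,
    conjTranspose_mul, conjTranspose_conjTranspose]
  rfl

open scoped ComplexOrder in
/-- A `2 × 2` positive semidefinite matrix is a nonnegative multiple of the identity iff its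
diagonal entries agree and its upper off-diagonal entry vanishes. -/
theorem Matrix.PosSemidef.exists_eq_smul_one_iff {A : Matrix (Fin 2) (Fin 2) ℂ}
    (hA : A.PosSemidef) :
    (∃ c : ℝ, 0 ≤ c ∧ A = (c : ℂ) • (1 : Matrix (Fin 2) (Fin 2) ℂ)) ↔
      A 0 0 - A 1 1 = 0 ∧ A 1 0 = 0 := by
  constructor
  · rintro ⟨c, -, rfl⟩
    simp
  · rintro ⟨hdiag, hoff⟩
    obtain ⟨hre, him⟩ := Complex.nonneg_iff.mp (hA.diag_nonneg (i := 0))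
    have hc : ((A 0 0).re : ℂ) = A 0 0 := Complex.ext rfl him
    have hoff' : A 0 1 = 0 := by rw [← hA.isHermitian.apply 0 1, hoff, star_zero]
    refine ⟨(A 0 0).re, hre, ?_⟩
    rw [hc]
    ext i j
    fin_cases i <;> fin_cases j <;> simp [hoff, hoff', (sub_eq_zero.mp hdiag).symm]

theorem prop_to_isometry_iff_trace_conditions (D : ℕ) (x y : Fin D → ℂ)
    (hx : ∑ k, star (x k) * x k = 1) (hy : ∑ k, star (y k) * y k = 1)
    (hxy : ∑ k, star (x k) * y k = 0)
    (P : Matrix (Fin D) (Fin 2) ℂ)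
    (hP0 : ∀ i, P i 0 = x i) (hP1 : ∀ i, P i 1 = y i)
    (M : Matrix (Fin D) (Fin D) ℂ) :
    (∃ c : ℝ, 0 ≤ c ∧
      (Pᴴ * M) * (Pᴴ * M)ᴴ = (c : ℂ) • (1 : Matrix (Fin 2) (Fin 2) ℂ))
    ↔
    ((Mᴴ * (vecMulVec x (star x) - vecMulVec y (star y)) * M).trace = 0 ∧
      (Mᴴ * vecMulVec x (star y) * M).trace = 0) := by
  obtain rfl : P.col 0 = x := funext hP0
  obtain rfl : P.col 1 = y := funext hP1
  rw [Matrix.mul_sub, Matrix.sub_mul, trace_sub]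
  simp only [trace_conjTranspose_mul_vecMulVec_mul]
  open scoped ComplexOrder in
  exact (posSemidef_self_mul_conjTranspose (Pᴴ * M)).exists_eq_smul_one_iff
end

section
/- Let A : Fin d → Matrix (Fin D) (Fin D) ℂ satisfy the completeness relation ∑ i, A i * (A i)ᴴ = 1, let P : Matrix (Fin D) (Fin 2) ℂ be an isometry, and suppose γ assigns to every word w (of any length N) a nonnegative real number such that Pᴴ * A_w * (A_w)ᴴ * P = (γ w) • (1 : Matrix (Fin 2) (Fin 2) ℂ). Then for every word w of length N, ∑_{i : Fin d} γ (w ⌢ i) = γ w (where w ⌢ i is w extended by the letter i), and consequently for every N, ∑_{w : Fin N → Fin d} γ w = 1. -/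
open Matrix BigOperators

theorem wordProd_snoc {d D N : ℕ} (A : Fin d → Matrix (Fin D) (Fin D) ℂ)
    (w : Fin N → Fin d) (i : Fin d) :
    wordProd A (Fin.snoc w i : Fin (N + 1) → Fin d) = wordProd A w * A i := by
  simp only [wordProd, List.ofFn_succ', List.concat_eq_append, List.prod_append,
    List.prod_singleton, Fin.snoc_castSucc, Fin.snoc_last]

/-- Right multiplication by a family with the completeness relation preserves `X * Xᴴ`. -/
theorem sum_mul_mul_conjTranspose {ι m n : Type*} [Fintype ι] [Fintype n] [DecidableEq n]
    (A : ι → Matrix n n ℂ) (hA : ∑ i, A i * (A i)ᴴ = 1) (X : Matrix m n ℂ) :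
    ∑ i, X * A i * (X * A i)ᴴ = X * Xᴴ := by
  have h (i : ι) : X * A i * (X * A i)ᴴ = X * (A i * (A i)ᴴ) * Xᴴ := by
    simp only [conjTranspose_mul, Matrix.mul_assoc]
  simp_rw [h]
  rw [← Matrix.sum_mul, ← Matrix.mul_sum, hA, Matrix.mul_one]

theorem gamma_telescoping (d D : ℕ) (A : Fin d → Matrix (Fin D) (Fin D) ℂ)
    (hA : ∑ i, A i * (A i)ᴴ = 1)
    (P : Matrix (Fin D) (Fin 2) ℂ) (hP : Pᴴ * P = 1)
    (γ : ∀ {N : ℕ}, (Fin N → Fin d) → ℝ)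
    (hγ0 : ∀ {N : ℕ} (w : Fin N → Fin d), 0 ≤ γ w)
    (hγ : ∀ {N : ℕ} (w : Fin N → Fin d),
      Pᴴ * wordProd A w * (wordProd A w)ᴴ * P =
        ((γ w : ℝ) : ℂ) • (1 : Matrix (Fin 2) (Fin 2) ℂ)) :
    (∀ (N : ℕ) (w : Fin N → Fin d), ∑ i : Fin d, γ (Fin.snoc w i) = γ w) ∧
    (∀ N : ℕ, ∑ w : Fin N → Fin d, γ w = 1) := by
  have extend (N : ℕ) (w : Fin N → Fin d) : ∑ i : Fin d, γ (Fin.snoc w i) = γ w := by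
    have key : ∑ i : Fin d, ((γ (Fin.snoc w i) : ℝ) : ℂ) • (1 : Matrix (Fin 2) (Fin 2) ℂ) =
        ((γ w : ℝ) : ℂ) • (1 : Matrix (Fin 2) (Fin 2) ℂ) := by
      simp_rw [← hγ, wordProd_snoc, Matrix.mul_assoc Pᴴ]
      rw [← Matrix.mul_sum, ← Matrix.sum_mul, sum_mul_mul_conjTranspose A hA]
    rw [← Finset.sum_smul] at key
    have entry := congrFun (congrFun key 0) 0
    simp only [Matrix.smul_apply, Matrix.one_apply_eq, smul_eq_mul, mul_one] at entry
    exact_mod_cast entry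
  refine ⟨extend, fun N => ?_⟩
  induction N with
  | zero =>
    have entry := congrFun (congrFun (hγ (Fin.elim0 : Fin 0 → Fin d)) 0) 0
    simp only [wordProd, List.ofFn_zero, List.prod_nil, conjTranspose_one, Matrix.mul_one, hP,
      Matrix.smul_apply, Matrix.one_apply_eq, smul_eq_mul, mul_one] at entry
    rw [Fintype.sum_unique, Subsingleton.elim default (Fin.elim0 : Fin 0 → Fin d)]
    exact_mod_cast entry.symm
  | succ N ih =>
    rw [← (Fin.snocEquiv fun _ : Fin (N + 1) => Fin d).sum_comp, Fintype.sum_prod_type_right,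
      ← ih]
    exact Finset.sum_congr rfl fun w _ => extend N w
end

section
/- Let A : Fin d → Matrix (Fin 2) (Fin 2) ℂ, and suppose there exist orthonormal vectors x y : Fin 2 → ℂ and a ℂ-submodule S of Matrix (Fin 2) (Fin 2) ℂ such that: vecMulVec x (star x) - vecMulVec y (star y) ∈ S, vecMulVec x (star y) ∈ S, vecMulVec y (star x) ∈ S, every X ∈ S has trace X = 0, and for every i and every X ∈ S one has (A i)ᴴ * X * (A i) ∈ S. Then for every i there exists c : ℂ with (A i) * (A i)ᴴ = c • (1 : Matrix (Fin 2) (Fin 2) ℂ); in particular each A i is a scalar multiple of a unitary matrix. -/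
open Matrix

/-- A `2 × 2` matrix which is trace-orthogonal to `|x)(x| - |y)(y|`, `|x)(y|` and `|y)(x|` for an
orthonormal pair `x`, `y` is a scalar matrix. -/
theorem eq_smul_one_of_trace_mul_eq_zero (M : Matrix (Fin 2) (Fin 2) ℂ) (x y : Fin 2 → ℂ)
    (hx : ∑ k, star (x k) * x k = 1) (hy : ∑ k, star (y k) * y k = 1)
    (hxy : ∑ k, star (x k) * y k = 0)
    (hV : ((vecMulVec x (star x) - vecMulVec y (star y)) * M).trace = 0)
    (hW : (vecMulVec x (star y) * M).trace = 0)
    (hW' : (vecMulVec y (star x) * M).trace = 0) :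
    ∃ c : ℂ, M = c • (1 : Matrix (Fin 2) (Fin 2) ℂ) := by
  have hyx : ∑ k, star (y k) * x k = 0 := by
    simpa [mul_comm] using congrArg star hxy
  let P : Matrix (Fin 2) (Fin 2) ℂ := !![x 0, y 0; x 1, y 1]
  have hP : Pᴴ * P = 1 := by
    simp only [Fin.sum_univ_two] at hx hy hxy hyx
    ext i j
    fin_cases i <;> fin_cases j <;>
      simpa [P, Matrix.mul_apply, Fin.sum_univ_two]
  have hP' : P * Pᴴ = 1 := mul_eq_one_comm.mp hP
  refine ⟨(vecMulVec x (star x) * M).trace, ?_⟩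
  set c := (vecMulVec x (star x) * M).trace with hc
  have key : Pᴴ * M * P = c • (1 : Matrix (Fin 2) (Fin 2) ℂ) := by
    simp only [Matrix.trace_fin_two, Matrix.mul_apply, Fin.sum_univ_two, Matrix.sub_apply,
      vecMulVec_apply, Pi.star_apply] at hV hW hW' hc
    ext i j
    fin_cases i <;> fin_cases j <;>
      simp [P, Matrix.mul_apply, Fin.sum_univ_two] at hV hW hW' hc ⊢
    · linear_combination -hc
    · linear_combination hW'
    · linear_combination hW
    · linear_combination -hc - hV
  calc M = (P * Pᴴ) * M * (P * Pᴴ) := by simp [hP']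
    _ = P * (Pᴴ * M * P) * Pᴴ := by simp only [Matrix.mul_assoc]
    _ = c • 1 := by simp [key, hP']

open scoped ComplexOrder in
/-- A square matrix with `B * Bᴴ` scalar is a scalar multiple of a unitary matrix. -/
theorem exists_eq_smul_unitary_of_mul_conjTranspose_eq_smul_one {n : Type*} [Fintype n]
    [DecidableEq n] (B : Matrix n n ℂ) (c : ℂ) (h : B * Bᴴ = c • (1 : Matrix n n ℂ)) :
    ∃ a : ℂ, ∃ U ∈ Matrix.unitaryGroup n ℂ, B = a • U := by
  by_cases hB : B = 0
  · exact ⟨0, 1, one_mem _, by simp [hB]⟩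
  obtain ⟨i⟩ : Nonempty n := by
    by_contra hn
    rw [not_nonempty_iff] at hn
    exact hB (Subsingleton.elim _ _)
  have hc0 : c ≠ 0 := by
    rintro rfl
    exact hB (self_mul_conjTranspose_eq_zero.mp (by simpa using h))
  have hre : c = ((∑ k, ‖B i k‖ ^ 2 : ℝ) : ℂ) := by
    have := congrFun (congrFun h i) i
    simp only [Matrix.mul_apply, conjTranspose_apply, Matrix.smul_apply, one_apply_eq,
      smul_eq_mul, mul_one] at this
    rw [← this]
    push_cast
    exact Finset.sum_congr rfl fun k _ => Complex.mul_conj' (B i k)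
  set r : ℝ := ∑ k, ‖B i k‖ ^ 2
  have hr : 0 ≤ r := Finset.sum_nonneg fun k _ => by positivity
  have hsq : ((√r : ℝ) : ℂ) * (√r : ℝ) = c := by
    rw [← Complex.ofReal_mul, Real.mul_self_sqrt hr, hre]
  have hs : ((√r : ℝ) : ℂ) ≠ 0 := by
    intro h0
    exact hc0 (by rw [← hsq, h0, mul_zero])
  refine ⟨(√r : ℝ), ((√r : ℝ) : ℂ)⁻¹ • B, ?_, by rw [smul_inv_smul₀ hs]⟩
  rw [mem_unitaryGroup_iff, star_eq_conjTranspose, conjTranspose_smul, smul_mul_smul_comm, h,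
    smul_smul, ← hsq]
  simp only [star_inv₀, Complex.star_def, Complex.conj_ofReal]
  rw [← mul_inv, inv_mul_cancel₀ (mul_ne_zero hs hs), one_smul]

theorem bond_dim_two_classification (d : ℕ)
    (A : Fin d → Matrix (Fin 2) (Fin 2) ℂ)
    (x y : Fin 2 → ℂ)
    (hx : ∑ k, star (x k) * x k = 1) (hy : ∑ k, star (y k) * y k = 1)
    (hxy : ∑ k, star (x k) * y k = 0)
    (S : Submodule ℂ (Matrix (Fin 2) (Fin 2) ℂ))
    (hV : vecMulVec x (star x) - vecMulVec y (star y) ∈ S)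
    (hW : vecMulVec x (star y) ∈ S)
    (hW' : vecMulVec y (star x) ∈ S)
    (htr : ∀ X ∈ S, X.trace = 0)
    (hclosed : ∀ i : Fin d, ∀ X ∈ S, (A i)ᴴ * X * (A i) ∈ S) :
    ∀ i : Fin d,
      (∃ c : ℂ, A i * (A i)ᴴ = c • (1 : Matrix (Fin 2) (Fin 2) ℂ)) ∧
      (∃ c : ℂ, ∃ U ∈ Matrix.unitaryGroup (Fin 2) ℂ, A i = c • U) := by
  intro i
  have htrace : ∀ X ∈ S, (X * (A i * (A i)ᴴ)).trace = 0 := fun X hX => by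
    rw [← htr _ (hclosed i X hX), Matrix.mul_assoc, Matrix.trace_mul_comm (A i)ᴴ,
      Matrix.mul_assoc]
  obtain ⟨c, hc⟩ := eq_smul_one_of_trace_mul_eq_zero (A i * (A i)ᴴ) x y hx hy hxy
    (htrace _ hV) (htrace _ hW) (htrace _ hW')
  exact ⟨⟨c, hc⟩, exists_eq_smul_unitary_of_mul_conjTranspose_eq_smul_one (A i) c hc⟩
end

section
/- Let A : Fin d → Matrix (Fin 3) (Fin 3) ℂ, let e₁ e₂ : Fin 3 → ℂ be the first two standard basis vectors, and set V := vecMulVec e₁ (star e₁) - vecMulVec e₂ (star e₂), W := vecMulVec e₁ (star e₂), and let S be the ℂ-span of {V, W, Wᴴ}. Suppose that for every i, (A i)ᴴ * V * (A i) ∈ S and (A i)ᴴ * W * (A i) ∈ S and (A i)ᴴ * Wᴴ * (A i) ∈ S. Then for every i: (A i) 0 2 = 0 and (A i) 1 2 = 0, and the upper-left 2×2 block B i of A i (with entries (A i) k l for k l ∈ {0,1}) satisfies (B i) * (B i)ᴴ = c • (1 : Matrix (Fin 2) (Fin 2) ℂ) for some real c ≥ 0. -/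
open Matrix

/-- The matrices in the span of `V`, `W`, `Wᴴ` have vanishing corner entry and vanishing trace on the
upper-left `2 × 2` block. -/
lemma corner_and_trace_of_mem_span {M V W : Matrix (Fin 3) (Fin 3) ℂ}
    (hV : V 2 2 = 0 ∧ V 0 0 + V 1 1 = 0) (hW : W 2 2 = 0 ∧ W 0 0 + W 1 1 = 0)
    (hM : M ∈ Submodule.span ℂ ({V, W, Wᴴ} : Set (Matrix (Fin 3) (Fin 3) ℂ))) :
    M 2 2 = 0 ∧ M 0 0 + M 1 1 = 0 := by
  induction hM using Submodule.span_induction with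
  | mem x hx =>
    rcases hx with rfl | rfl | rfl
    · exact hV
    · exact hW
    · refine ⟨by simp [hW.1], ?_⟩
      rw [conjTranspose_apply, conjTranspose_apply, ← star_add, hW.2, star_zero]
  | zero => simp
  | add x y _ _ hx hy =>
    refine ⟨by simp [hx.1, hy.1], ?_⟩
    simp only [Matrix.add_apply]
    linear_combination hx.2 + hy.2
  | smul a x _ hx =>
    refine ⟨by simp [hx.1], ?_⟩
    simp only [Matrix.smul_apply, smul_eq_mul]
    linear_combination a * hx.2

theorem nmin_three_case (d : ℕ) (A : Fin d → Matrix (Fin 3) (Fin 3) ℂ)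
    (e₁ e₂ : Fin 3 → ℂ)
    (he₁ : e₁ = fun k => if k = 0 then 1 else 0)
    (he₂ : e₂ = fun k => if k = 1 then 1 else 0)
    (V W : Matrix (Fin 3) (Fin 3) ℂ)
    (hV : V = vecMulVec e₁ (star e₁) - vecMulVec e₂ (star e₂))
    (hW : W = vecMulVec e₁ (star e₂))
    (S : Submodule ℂ (Matrix (Fin 3) (Fin 3) ℂ))
    (hS : S = Submodule.span ℂ ({V, W, Wᴴ} : Set (Matrix (Fin 3) (Fin 3) ℂ)))
    (hclosed : ∀ i : Fin d,
      (A i)ᴴ * V * A i ∈ S ∧ (A i)ᴴ * W * A i ∈ S ∧ (A i)ᴴ * Wᴴ * A i ∈ S) :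
    ∀ i : Fin d,
      A i 0 2 = 0 ∧ A i 1 2 = 0 ∧
      ∃ c : ℝ, 0 ≤ c ∧
        ((A i).submatrix (Fin.castSucc : Fin 2 → Fin 3) Fin.castSucc) *
          ((A i).submatrix (Fin.castSucc : Fin 2 → Fin 3) Fin.castSucc)ᴴ =
          (c : ℂ) • (1 : Matrix (Fin 2) (Fin 2) ℂ) := by
  intro i
  subst hS
  have hV' : V 2 2 = 0 ∧ V 0 0 + V 1 1 = 0 := by
    subst hV he₁ he₂; simp [vecMulVec_apply]
  have hW' : W 2 2 = 0 ∧ W 0 0 + W 1 1 = 0 := by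
    subst hW he₁ he₂; simp [vecMulVec_apply]
  obtain ⟨hv, hw, hw'⟩ := hclosed i
  obtain ⟨v22, vtr⟩ := corner_and_trace_of_mem_span hV' hW' hv
  obtain ⟨w22, wtr⟩ := corner_and_trace_of_mem_span hV' hW' hw
  obtain ⟨-, wtr'⟩ := corner_and_trace_of_mem_span hV' hW' hw'
  clear hv hw hw' hV' hW' hclosed
  subst hV hW he₁ he₂
  simp [Matrix.mul_apply, Fin.sum_univ_three, vecMulVec_apply] at v22 vtr w22 wtr wtr'
  have h02 : A i 0 2 = 0 := by
    rcases w22 with h | h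
    · exact h
    · simpa [h] using v22
  have h12 : A i 1 2 = 0 := by simpa [h02] using v22
  refine ⟨h02, h12, Complex.normSq (A i 0 0) + Complex.normSq (A i 0 1),
    add_nonneg (Complex.normSq_nonneg _) (Complex.normSq_nonneg _), ?_⟩
  ext k l
  fin_cases k <;> fin_cases l <;>
    simp [Matrix.mul_apply, Complex.normSq_eq_conj_mul_self]
  · ring
  · linear_combination wtr'
  · linear_combination wtr
  · linear_combination -vtr
end

section
/- Let e₁ e₂ e₃ : Fin 3 → ℂ be the standard basis vectors, and let x' : Fin 3 → ℂ be a unit vector with ⟪e₂, x'⟫ = 0 and x' not a scalar multiple of e₁. Let n' : Fin 3 → ℂ be a unit vector with ⟪n', x'⟫ = 0 and ⟪n', e₂⟫ = 0. Set V := vecMulVec e₁ (star e₁) - vecMulVec e₂ (star e₂), W := vecMulVec e₁ (star e₂), V' := vecMulVec x' (star x') - vecMulVec e₂ (star e₂), W' := vecMulVec x' (star e₂), and let S be the ℂ-span of {V, W, Wᴴ, V', W', W'ᴴ}. Then the orthogonal complement of S in Matrix (Fin 3) (Fin 3) ℂ with respect to the Hilbert–Schmidt inner product ⟨X, Y⟩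 = trace (Xᴴ * Y) equals the ℂ-span of {1, vecMulVec e₃ (star n'), vecMulVec n' (star e₃)}. -/
open Matrix

/-- A matrix is orthogonal to the span of a set for the Hilbert–Schmidt inner product iff it is
orthogonal to every element of the set. -/
theorem forall_mem_span_trace_conjTranspose_mul_eq_zero_iff {n : Type*} [Fintype n]
    (s : Set (Matrix n n ℂ)) (Y : Matrix n n ℂ) :
    (∀ X ∈ Submodule.span ℂ s, (Xᴴ * Y).trace = 0) ↔ ∀ X ∈ s, (Xᴴ * Y).trace = 0 := by
  refine ⟨fun h X hX => h X (Submodule.subset_span hX), fun h X hX => ?_⟩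
  induction hX using Submodule.span_induction with
  | mem X hX => exact h X hX
  | zero => simp
  | add A B _ _ hA hB => simp [Matrix.add_mul, hA, hB]
  | smul c A _ hA => simp [hA]

/-- The Hilbert–Schmidt inner product with a rank-one matrix is a matrix element. -/
theorem trace_conjTranspose_vecMulVec_star_mul {n : Type*} [Fintype n]
    (x y : n → ℂ) (Y : Matrix n n ℂ) :
    ((vecMulVec x (star y))ᴴ * Y).trace = star x ⬝ᵥ Y *ᵥ y := by
  rw [conjTranspose_vecMulVec, star_star, vecMulVec_mul, trace_vecMulVec, dotProduct_comm,
    dotProduct_mulVec]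

theorem nmin_six_orthogonal_complement
    (e₁ e₂ e₃ : Fin 3 → ℂ)
    (he₁ : e₁ = fun k => if k = 0 then 1 else 0)
    (he₂ : e₂ = fun k => if k = 1 then 1 else 0)
    (he₃ : e₃ = fun k => if k = 2 then 1 else 0)
    (x' : Fin 3 → ℂ)
    (hx'norm : ∑ k, star (x' k) * x' k = 1)
    (hx'e₂ : ∑ k, star (e₂ k) * x' k = 0)
    (hx'e₁ : ¬∃ c : ℂ, x' = c • e₁)
    (n' : Fin 3 → ℂ)
    (hn'norm : ∑ k, star (n' k) * n' k = 1)
    (hn'x' : ∑ k, star (n' k) * x' k = 0)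
    (hn'e₂ : ∑ k, star (n' k) * e₂ k = 0)
    (V W V' W' : Matrix (Fin 3) (Fin 3) ℂ)
    (hV : V = vecMulVec e₁ (star e₁) - vecMulVec e₂ (star e₂))
    (hW : W = vecMulVec e₁ (star e₂))
    (hV' : V' = vecMulVec x' (star x') - vecMulVec e₂ (star e₂))
    (hW' : W' = vecMulVec x' (star e₂))
    (S : Submodule ℂ (Matrix (Fin 3) (Fin 3) ℂ))
    (hS : S = Submodule.span ℂ
      ({V, W, Wᴴ, V', W', W'ᴴ} : Set (Matrix (Fin 3) (Fin 3) ℂ))) :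
    {Y : Matrix (Fin 3) (Fin 3) ℂ | ∀ X ∈ S, (Xᴴ * Y).trace = 0} =
      (Submodule.span ℂ
        ({1, vecMulVec e₃ (star n'), vecMulVec n' (star e₃)} :
          Set (Matrix (Fin 3) (Fin 3) ℂ)) : Set (Matrix (Fin 3) (Fin 3) ℂ)) := by
  have hx1 : x' 1 = 0 := by simpa [he₂, Fin.sum_univ_three] using hx'e₂
  have hn1 : n' 1 = 0 := by simpa [he₂, Fin.sum_univ_three] using hn'e₂
  have hx2 : x' 2 ≠ 0 := by
    refine fun h => hx'e₁ ⟨x' 0, ?_⟩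
    ext k
    fin_cases k <;> simp [he₁, hx1, h]
  simp only [Fin.sum_univ_three, hx1, hn1, mul_zero, add_zero] at hx'norm hn'norm hn'x'
  have hn0 : n' 0 ≠ 0 := by
    intro h
    have hn2 : n' 2 = 0 := by simpa [h, hx2] using hn'x'
    simp [h, hn2] at hn'norm
  have hsx2 : star (x' 2) ≠ 0 := star_ne_zero.mpr hx2
  have hsn0 : star (n' 0) ≠ 0 := star_ne_zero.mpr hn0
  have hn'x'_star : n' 0 * star (x' 0) + n' 2 * star (x' 2) = 0 := by
    simpa [mul_comm] using congrArg star hn'x'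
  have hWt : Wᴴ = vecMulVec e₂ (star e₁) := by
    rw [hW, conjTranspose_vecMulVec, star_star]
  have hWt' : W'ᴴ = vecMulVec e₂ (star x') := by
    rw [hW', conjTranspose_vecMulVec, star_star]
  ext Y
  rw [hS, Set.mem_ofPred_eq, forall_mem_span_trace_conjTranspose_mul_eq_zero_iff,
    SetLike.mem_coe, Submodule.mem_span_triple, hWt, hWt', hV, hV', hW, hW']
  simp only [Set.forall_mem_insert, Set.mem_singleton_iff, forall_eq, conjTranspose_sub,
    Matrix.sub_mul, trace_sub, trace_conjTranspose_vecMulVec_star_mul]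
  simp only [he₁, he₂, he₃, dotProduct, mulVec, Fin.sum_univ_three, Pi.star_apply, hx1]
  simp only [Fin.isValue, one_ne_zero, zero_ne_one, Fin.reduceEq, if_true, if_false, star_one,
    star_zero, mul_one, one_mul, mul_zero, zero_mul, add_zero, zero_add]
  constructor
  · rintro ⟨h1, h2, h3, h4, h5, h6⟩
    have h21 : Y 2 1 = 0 := by simpa [h2, hx2] using h5
    have h12 : Y 1 2 = 0 := by simpa [h3, hx2] using h6
    refine ⟨Y 1 1, Y 2 0 / star (n' 0), Y 0 2 / n' 0, ?_⟩
    have h00 : Y 0 0 = Y 1 1 := sub_eq_zero.mp h1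
    have h22 : Y 1 1 + Y 2 0 / star (n' 0) * star (n' 2) + Y 0 2 / n' 0 * n' 2 = Y 2 2 := by
      have hd : star (n' 2) / star (n' 0) = -x' 0 / x' 2 := by
        rw [div_eq_div_iff hsn0 hx2]
        linear_combination hn'x'
      have hf : n' 2 / n' 0 = -star (x' 0) / star (x' 2) := by
        rw [div_eq_div_iff hn0 hsx2]
        linear_combination hn'x'_star
      rw [div_mul_eq_mul_div, div_mul_eq_mul_div, mul_div_assoc, mul_div_assoc, hd, hf]
      field_simp
      linear_combination Y 1 1 * hx'norm - h4 + star (x' 0) * x' 0 * h00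
    ext i j
    fin_cases i <;> fin_cases j <;>
      simp [vecMulVec_apply, hn1, h2, h3, h21, h12, h00, hn0]
    simpa using h22
  · rintro ⟨c, d, f, rfl⟩
    simp only [← starRingEnd_apply] at hx'norm hn'x' hn'x'_star
    simp [vecMulVec_apply, hn1]
    linear_combination c * hx'norm + d * starRingEnd ℂ (x' 2) * hn'x' + f * x' 2 * hn'x'_star
end
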